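/- Let p₁, p₂ ∈ P and H₁, H₂ ∈ S₂(H). Then the function t ↦ d(p₁^{1/2} exp(t H₁) p₁^{1/2}, p₂^{1/2} exp(t H₂) p₂^{1/2}) is a convex function of t on ℝ; i.e., the distance between two constant-speed geodesics of P is a convex function of the parameter. -/

import Mathlib

noncomputable section

open scoped InnerProductSpace

variable {H : Type*} [NormedAddCommGroup H] [InnerProductSpace ℂ H] [CompleteSpace H]
variable {ι : Type*}

/-- `A` is a Hilbert–Schmidt operator (w.r.t. the Hilbert basis `e`). -/
def IsHS (e : HilbertBasis ι ℂ H) (A : H →L[ℂ] H) : Prop :=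
  Summable fun i => ‖A (e i)‖ ^ 2

/-- The Hilbert–Schmidt norm of `A` (w.r.t. the Hilbert basis `e`). -/
def hsNorm (e : HilbertBasis ι ℂ H) (A : H →L[ℂ] H) : ℝ :=
  Real.sqrt (∑' i, ‖A (e i)‖ ^ 2)

/-- The real Hilbert–Schmidt inner product `⟨A, B⟩₂ = ∑ ⟪A eᵢ, B eᵢ⟫`. -/
def hsInner (e : HilbertBasis ι ℂ H) (A B : H →L[ℂ] H) : ℝ :=
  (∑' i, (inner ℂ (A (e i)) (B (e i)) : ℂ)).re

/-- The trace of an operator, `Tr T = ∑ ⟪eᵢ, T eᵢ⟫`. -/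
def opTrace (e : HilbertBasis ι ℂ H) (T : H →L[ℂ] H) : ℂ :=
  ∑' i, (inner ℂ (e i) (T (e i)) : ℂ)

/-- `T` is trace class: it is the product of two Hilbert–Schmidt operators. -/
def IsTraceClass (e : HilbertBasis ι ℂ H) (T : H →L[ℂ] H) : Prop :=
  ∃ B C : H →L[ℂ] H, IsHS e B ∧ IsHS e C ∧ T = B * C

/-- `A ∈ S₂(H)`: self-adjoint and Hilbert–Schmidt. -/
def MemS2 (e : HilbertBasis ι ℂ H) (A : H →L[ℂ] H) : Prop :=
  IsSelfAdjoint A ∧ IsHS e A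

/-- `p ∈ P`: self-adjoint, positive definite (invertible and `⟪p x, x⟫ ≥ 0`),
with `p - 1` Hilbert–Schmidt. -/
def MemP (e : HilbertBasis ι ℂ H) (p : H →L[ℂ] H) : Prop :=
  IsSelfAdjoint p ∧ IsUnit p ∧ (∀ x : H, 0 ≤ (inner ℂ (p x) x : ℂ).re) ∧ IsHS e (p - 1)

/-- `x ∈ GL₂(H)`: invertible with `x - 1` Hilbert–Schmidt. -/
def MemGL2 (e : HilbertBasis ι ℂ H) (x : H →L[ℂ] H) : Prop :=
  IsUnit x ∧ IsHS e (x - 1)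

/-- `x ∈ U₂(H)`: unitary with `x - 1` Hilbert–Schmidt. -/
def MemU2 (e : HilbertBasis ι ℂ H) (x : H →L[ℂ] H) : Prop :=
  x ∈ unitary (H →L[ℂ] H) ∧ IsHS e (x - 1)

/-- `p^{1/2}`, via continuous functional calculus. -/
def psqrt (p : H →L[ℂ] H) : H →L[ℂ] H := cfc Real.sqrt p

/-- `p^{-1/2}`, via continuous functional calculus. -/
def pinvsqrt (p : H →L[ℂ] H) : H →L[ℂ] H := cfc (fun t : ℝ => (Real.sqrt t)⁻¹) p

/-- `log p`, via continuous functional calculus. -/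
def plog (p : H →L[ℂ] H) : H →L[ℂ] H := cfc Real.log p

/-- The geodesic distance `d(p, q) = ‖log (p^{-1/2} q p^{-1/2})‖₂`. -/
def gdist (e : HilbertBasis ι ℂ H) (p q : H →L[ℂ] H) : ℝ :=
  hsNorm e (plog (pinvsqrt p * q * pinvsqrt p))

/-- The commutator `[A, B] = AB - BA`. -/
def brk (A B : H →L[ℂ] H) : H →L[ℂ] H := A * B - B * A

/-- The constant-speed geodesic `t ↦ p^{1/2} exp(t K) p^{1/2}`. -/
def geoCurve (p K : H →L[ℂ] H) (t : ℝ) : H →L[ℂ] H :=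
  psqrt p * NormedSpace.exp (t • K) * psqrt p

/-- The geodesic from `p` to `q`:
`t ↦ p^{1/2} exp(t log(p^{-1/2} q p^{-1/2})) p^{1/2}`. -/
def geodesic (p q : H →L[ℂ] H) (t : ℝ) : H →L[ℂ] H :=
  geoCurve p (plog (pinvsqrt p * q * pinvsqrt p)) t

/-- The image `exp E` of a set of operators under the exponential map. -/
def expSet (E : Set (H →L[ℂ] H)) : Set (H →L[ℂ] H) := NormedSpace.exp '' E

/-- The orthogonal complement of `E` inside `S₂(H)` for the Hilbert–Schmidt
inner product. -/
def hsPerp (e : HilbertBasis ι ℂ H) (E : Set (H →L[ℂ] H)) : Set (H →L[ℂ] H) :=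
  {Y | MemS2 e Y ∧ ∀ X ∈ E, hsInner e X Y = 0}

/-- `E` is closed in `S₂(H)` with respect to the Hilbert–Schmidt norm. -/
def IsHSClosed (e : HilbertBasis ι ℂ H) (E : Set (H →L[ℂ] H)) : Prop :=
  ∀ X : H →L[ℂ] H, MemS2 e X → (∀ ε > (0:ℝ), ∃ Y ∈ E, hsNorm e (X - Y) < ε) → X ∈ E

set_option linter.unusedSectionVars false

theorem isHS_iff_memlp (e : HilbertBasis ι ℂ H) (A : H →L[ℂ] H) :
    IsHS e A ↔ Memℓp (fun i => A (e i)) 2 := by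
  rw [memℓp_gen_iff (by norm_num)]
  simp [IsHS]

open Classical in
/-- The vector of values of `A` on the basis, as an element of `ℓ²(ι, H)`. -/
def hsv (e : HilbertBasis ι ℂ H) (A : H →L[ℂ] H) : lp (fun _ : ι => H) 2 :=
  if h : Memℓp (fun i => A (e i)) 2 then ⟨fun i => A (e i), h⟩ else 0

theorem hsv_apply (e : HilbertBasis ι ℂ H) {A : H →L[ℂ] H} (hA : IsHS e A) (i : ι) :
    (hsv e A) i = A (e i) := by
  rw [isHS_iff_memlp] at hA
  simp [hsv, hA]

theorem norm_hsv (e : HilbertBasis ι ℂ H) {A : H →L[ℂ] H} (hA : IsHS e A) :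
    ‖hsv e A‖ = hsNorm e A := by
  rw [lp.norm_eq_tsum_rpow (by norm_num), hsNorm, Real.sqrt_eq_rpow]
  simp [hsv_apply e hA]

theorem IsHS.add {e : HilbertBasis ι ℂ H} {A B : H →L[ℂ] H} (hA : IsHS e A) (hB : IsHS e B) :
    IsHS e (A + B) := by
  rw [isHS_iff_memlp] at *
  exact hA.add hB

theorem IsHS.smul {e : HilbertBasis ι ℂ H} {A : H →L[ℂ] H} (hA : IsHS e A) (r : ℝ) :
    IsHS e (r • A) := by
  rw [isHS_iff_memlp] at *
  exact hA.const_smul r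

theorem IsHS.neg {e : HilbertBasis ι ℂ H} {A : H →L[ℂ] H} (hA : IsHS e A) :
    IsHS e (-A) := by
  rw [isHS_iff_memlp] at *
  exact hA.neg

theorem IsHS.sub {e : HilbertBasis ι ℂ H} {A B : H →L[ℂ] H} (hA : IsHS e A) (hB : IsHS e B) :
    IsHS e (A - B) := by
  rw [sub_eq_add_neg]; exact hA.add hB.neg

theorem IsHS.zero (e : HilbertBasis ι ℂ H) : IsHS e 0 := by
  simp [IsHS]

theorem IsHS.mul_left {e : HilbertBasis ι ℂ H} {A : H →L[ℂ] H} (hA : IsHS e A)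
    (B : H →L[ℂ] H) : IsHS e (B * A) := by
  refine Summable.of_nonneg_of_le (fun i => by positivity) (fun i => ?_)
    (Summable.mul_left (‖B‖ ^ 2) hA)
  rw [← mul_pow]
  gcongr
  exact B.le_opNorm _

theorem hsv_add {e : HilbertBasis ι ℂ H} {A B : H →L[ℂ] H} (hA : IsHS e A) (hB : IsHS e B) :
    hsv e (A + B) = hsv e A + hsv e B := by
  ext i
  simp [hsv_apply e hA, hsv_apply e hB, hsv_apply e (hA.add hB)]

theorem hsv_smul {e : HilbertBasis ι ℂ H} {A : H →L[ℂ] H} (hA : IsHS e A) (r : ℝ) :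
    hsv e (r • A) = r • hsv e A := by
  ext i
  simp [hsv_apply e hA, hsv_apply e (hA.smul r)]

theorem hsv_sub {e : HilbertBasis ι ℂ H} {A B : H →L[ℂ] H} (hA : IsHS e A) (hB : IsHS e B) :
    hsv e (A - B) = hsv e A - hsv e B := by
  ext i
  simp [hsv_apply e hA, hsv_apply e hB, hsv_apply e (hA.sub hB)]

theorem hsNorm_nonneg (e : HilbertBasis ι ℂ H) (A : H →L[ℂ] H) : 0 ≤ hsNorm e A :=
  Real.sqrt_nonneg _

theorem hsNorm_sq {e : HilbertBasis ι ℂ H} {A : H →L[ℂ] H} :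
    hsNorm e A ^ 2 = ∑' i, ‖A (e i)‖ ^ 2 :=
  Real.sq_sqrt (tsum_nonneg fun i => by positivity)

theorem hsNorm_mul_left {e : HilbertBasis ι ℂ H} {A : H →L[ℂ] H} (hA : IsHS e A)
    (B : H →L[ℂ] H) : hsNorm e (B * A) ≤ ‖B‖ * hsNorm e A := by
  refine le_of_sq_le_sq ?_ (by have := hsNorm_nonneg e A; positivity)
  rw [mul_pow, hsNorm_sq, hsNorm_sq, ← tsum_mul_left]
  refine (hA.mul_left B).tsum_le_tsum (fun i => ?_) (Summable.mul_left (‖B‖ ^ 2) hA)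
  rw [← mul_pow]
  gcongr
  exact B.le_opNorm _

theorem parseval_enn (e : HilbertBasis ι ℂ H) (x : H) :
    ∑' j, ENNReal.ofReal (‖inner ℂ (e j) x‖ ^ 2) = ENNReal.ofReal (‖x‖ ^ 2) := by
  have h := (e.hasSum_inner_mul_inner x x).mapL Complex.reCLM
  have h2 : HasSum (fun j => ‖inner ℂ (e j) x‖ ^ 2) (‖x‖ ^ 2) := by
    convert h using 1
    · ext j
      rw [← inner_conj_symm x (e j), Complex.conj_mul', ← Complex.ofReal_pow]
      simp [-Complex.ofReal_pow]
    · simp [inner_self_eq_norm_sq_to_K, ← Complex.ofReal_pow]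
  rw [← h2.tsum_eq, ENNReal.ofReal_tsum_of_nonneg (fun j => by positivity) h2.summable]

theorem hs_enn_star (e : HilbertBasis ι ℂ H) (A : H →L[ℂ] H) :
    ∑' i, ENNReal.ofReal (‖(star A) (e i)‖ ^ 2) = ∑' i, ENNReal.ofReal (‖A (e i)‖ ^ 2) := by
  simp_rw [← parseval_enn e]
  rw [ENNReal.tsum_comm]
  refine tsum_congr fun i => tsum_congr fun j => ?_
  rw [ContinuousLinearMap.star_eq_adjoint, ContinuousLinearMap.adjoint_inner_right,
    norm_inner_symm]

theorem isHS_iff_enn (e : HilbertBasis ι ℂ H) (A : H →L[ℂ] H) :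
    IsHS e A ↔ ∑' i, ENNReal.ofReal (‖A (e i)‖ ^ 2) ≠ ⊤ := by
  constructor
  · intro h
    exact Summable.tsum_ofReal_ne_top h
  · intro h
    have := ENNReal.summable_toReal h
    simpa [IsHS] using this

theorem IsHS.star {e : HilbertBasis ι ℂ H} {A : H →L[ℂ] H} (hA : IsHS e A) :
    IsHS e (star A) := by
  rw [isHS_iff_enn, hs_enn_star, ← isHS_iff_enn]; exact hA

theorem hsNorm_eq_enn (e : HilbertBasis ι ℂ H) (A : H →L[ℂ] H) :
    hsNorm e A = Real.sqrt (∑' i, ENNReal.ofReal (‖A (e i)‖ ^ 2)).toReal := by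
  rw [ENNReal.tsum_toReal_eq (fun i => ENNReal.ofReal_ne_top)]
  simp [hsNorm]

theorem hsNorm_star (e : HilbertBasis ι ℂ H) (A : H →L[ℂ] H) :
    hsNorm e (star A) = hsNorm e A := by
  rw [hsNorm_eq_enn, hs_enn_star, ← hsNorm_eq_enn]

theorem IsHS.mul_right {e : HilbertBasis ι ℂ H} {A : H →L[ℂ] H} (hA : IsHS e A)
    (B : H →L[ℂ] H) : IsHS e (A * B) := by
  have := (hA.star.mul_left (Star.star B)).star
  simpa using this

theorem hsNorm_mul_right {e : HilbertBasis ι ℂ H} {A : H →L[ℂ] H} (hA : IsHS e A)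
    (B : H →L[ℂ] H) : hsNorm e (A * B) ≤ hsNorm e A * ‖B‖ := by
  have := hsNorm_mul_left hA.star (Star.star B)
  rwa [← star_mul, hsNorm_star, hsNorm_star, norm_star, mul_comm] at this

/-- Real Hilbert-Schmidt pairing, through `ℓ²(ι, H)`. -/
def hsip (e : HilbertBasis ι ℂ H) (A B : H →L[ℂ] H) : ℝ :=
  (inner ℂ (hsv e A) (hsv e B) : ℂ).re

theorem hsip_eq {e : HilbertBasis ι ℂ H} {A B : H →L[ℂ] H} (hA : IsHS e A) (hB : IsHS e B) :
    hsip e A B = (hsNorm e (A + B) ^ 2 - hsNorm e A ^ 2 - hsNorm e B ^ 2) / 2 := by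
  have := norm_add_sq (𝕜 := ℂ) (hsv e A) (hsv e B)
  rw [← hsv_add hA hB, norm_hsv e hA, norm_hsv e hB, norm_hsv e (hA.add hB)] at this
  rw [this, hsip]
  simp only [RCLike.re_to_complex]
  ring

theorem hsip_star {e : HilbertBasis ι ℂ H} {A B : H →L[ℂ] H} (hA : IsHS e A) (hB : IsHS e B) :
    hsip e (star A) (star B) = hsip e A B := by
  rw [hsip_eq hA hB, hsip_eq hA.star hB.star, ← star_add, hsNorm_star, hsNorm_star, hsNorm_star]

theorem hsip_mul_left {e : HilbertBasis ι ℂ H} {A B X : H →L[ℂ] H} (hA : IsHS e A)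
    (hB : IsHS e B) (hX : IsSelfAdjoint X) :
    hsip e (X * A) B = hsip e A (X * B) := by
  unfold hsip
  rw [lp.inner_eq_tsum, lp.inner_eq_tsum]
  congr 1
  refine tsum_congr fun i => ?_
  rw [hsv_apply e (hA.mul_left X), hsv_apply e (hB.mul_left X), hsv_apply e hA, hsv_apply e hB]
  have h := ContinuousLinearMap.adjoint_inner_left X (B (e i)) (A (e i))
  rw [← ContinuousLinearMap.star_eq_adjoint, hX.star_eq] at h
  exact h

theorem hsip_mul_right {e : HilbertBasis ι ℂ H} {A B X : H →L[ℂ] H} (hA : IsHS e A)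
    (hB : IsHS e B) (hX : IsSelfAdjoint X) :
    hsip e (A * X) B = hsip e A (B * X) := by
  rw [← hsip_star (hA.mul_right X) hB, ← hsip_star hA (hB.mul_right X), star_mul, star_mul,
    hX.star_eq]
  exact hsip_mul_left hA.star hB.star hX

theorem hsip_self {e : HilbertBasis ι ℂ H} {A : H →L[ℂ] H} (hA : IsHS e A) :
    hsip e A A = hsNorm e A ^ 2 := by
  rw [hsip, ← norm_hsv e hA, inner_self_eq_norm_sq_to_K]
  simp [← Complex.ofReal_pow]

theorem hsNorm_add_le {e : HilbertBasis ι ℂ H} {A B : H →L[ℂ] H} (hA : IsHS e A)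
    (hB : IsHS e B) : hsNorm e (A + B) ≤ hsNorm e A + hsNorm e B := by
  rw [← norm_hsv e hA, ← norm_hsv e hB, ← norm_hsv e (hA.add hB), hsv_add hA hB]
  exact norm_add_le _ _

theorem hsNorm_neg (e : HilbertBasis ι ℂ H) (A : H →L[ℂ] H) : hsNorm e (-A) = hsNorm e A := by
  simp [hsNorm]

theorem hsNorm_sub_le {e : HilbertBasis ι ℂ H} {A B : H →L[ℂ] H} (hA : IsHS e A)
    (hB : IsHS e B) : hsNorm e (A - B) ≤ hsNorm e A + hsNorm e B := by
  rw [sub_eq_add_neg, ← hsNorm_neg e B]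
  exact hsNorm_add_le hA hB.neg

theorem hsNorm_smul (e : HilbertBasis ι ℂ H) (A : H →L[ℂ] H) (r : ℝ) :
    hsNorm e (r • A) = |r| * hsNorm e A := by
  have : ∀ i, ‖(r • A) (e i)‖ ^ 2 = r ^ 2 * ‖A (e i)‖ ^ 2 := fun i => by
    simp [norm_smul, mul_pow]
  rw [hsNorm, hsNorm, tsum_congr this, tsum_mul_left, Real.sqrt_mul (sq_nonneg r),
    Real.sqrt_sq_eq_abs]

theorem hsNorm_unitary_left (e : HilbertBasis ι ℂ H) (A : H →L[ℂ] H) {U : H →L[ℂ] H}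
    (hU : star U * U = 1) : hsNorm e (U * A) = hsNorm e A := by
  have h : ∀ x, ‖U x‖ = ‖x‖ := by
    rw [ContinuousLinearMap.norm_map_iff_adjoint_comp_self]
    exact hU
  simp [hsNorm, h]

theorem hsNorm_unitary_right (e : HilbertBasis ι ℂ H) (A : H →L[ℂ] H) {U : H →L[ℂ] H}
    (hU : U * star U = 1) : hsNorm e (A * U) = hsNorm e A := by
  rw [← hsNorm_star, star_mul, hsNorm_unitary_left _ _ (by simpa using hU), hsNorm_star]
theorem hasSum_congr_both {E : Type*} [AddCommMonoid E] [TopologicalSpace E] {f g : ℕ → E}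
    {a b : E} (h : ∀ n, f n = g n) (hab : a = b) : HasSum f a ↔ HasSum g b := by
  rw [funext h, hab]


theorem clm_mul_app {E : Type*} [NormedAddCommGroup E] [NormedSpace ℝ E] (f g : E →L[ℝ] E)
    (x : E) : (f * g) x = f (g x) := rfl

theorem hasSum_op_exp (X T : H →L[ℂ] H) :
    HasSum (fun n : ℕ => ((n.factorial : ℝ)⁻¹) • (X ^ n * T)) (NormedSpace.exp X * T) := by
  have h := (NormedSpace.exp_series_hasSum_exp' (𝕂 := ℝ) X).mul_right T
  simpa [smul_mul_assoc] using h

theorem exp_mulLeft_apply (X T : H →L[ℂ] H) :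
    NormedSpace.exp (ContinuousLinearMap.mul ℝ (H →L[ℂ] H) X) T = NormedSpace.exp X * T := by
  have h := (NormedSpace.exp_series_hasSum_exp' (𝕂 := ℝ)
    (ContinuousLinearMap.mul ℝ (H →L[ℂ] H) X)).mapL (ContinuousLinearMap.apply ℝ _ T)
  refine HasSum.unique h ?_
  refine (hasSum_congr_both ?_ rfl).mpr (hasSum_op_exp X T)
  intro n
  have : ∀ n : ℕ, (ContinuousLinearMap.mul ℝ (H →L[ℂ] H) X ^ n) T = X ^ n * T := by
    intro n
    induction n with
    | zero => simp
    | succ n ih =>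
      rw [pow_succ', pow_succ', clm_mul_app, ih]
      simp [mul_assoc]
  simp [this]

theorem exp_mulRight_apply (Y T : H →L[ℂ] H) :
    NormedSpace.exp ((ContinuousLinearMap.mul ℝ (H →L[ℂ] H)).flip Y) T
      = T * NormedSpace.exp Y := by
  have h := (NormedSpace.exp_series_hasSum_exp' (𝕂 := ℝ)
    ((ContinuousLinearMap.mul ℝ (H →L[ℂ] H)).flip Y)).mapL (ContinuousLinearMap.apply ℝ _ T)
  refine HasSum.unique h ?_
  have h2 := (NormedSpace.exp_series_hasSum_exp' (𝕂 := ℝ) Y).mul_left T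
  refine (hasSum_congr_both ?_ rfl).mpr h2
  intro n
  have : ∀ n : ℕ, ((ContinuousLinearMap.mul ℝ (H →L[ℂ] H)).flip Y ^ n) T = T * Y ^ n := by
    intro n
    induction n with
    | zero => simp
    | succ n ih =>
      rw [pow_succ', pow_succ, clm_mul_app, ih]
      simp [mul_assoc]
  simp [this]

/-- The generalized commutator `T ↦ X T - T Y`. -/
def gcom (X Y : H →L[ℂ] H) : (H →L[ℂ] H) →L[ℝ] (H →L[ℂ] H) :=
  ContinuousLinearMap.mul ℝ (H →L[ℂ] H) X + (ContinuousLinearMap.mul ℝ (H →L[ℂ] H)).flip (-Y)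

theorem gcom_apply (X Y T : H →L[ℂ] H) : gcom X Y T = X * T - T * Y := by
  simp [gcom, sub_eq_add_neg]

theorem exp_gcom (X Y : H →L[ℂ] H) :
    NormedSpace.exp (gcom X Y) 1 = NormedSpace.exp X * NormedSpace.exp (-Y) := by
  have hc : Commute (ContinuousLinearMap.mul ℝ (H →L[ℂ] H) X)
      ((ContinuousLinearMap.mul ℝ (H →L[ℂ] H)).flip (-Y)) := by
    ext T x
    simp
  let +nondep : NormedAlgebra ℚ ((H →L[ℂ] H) →L[ℝ] (H →L[ℂ] H)) :=
    NormedAlgebra.restrictScalars ℚ ℝ _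
  rw [gcom, NormedSpace.exp_add_of_commute hc, clm_mul_app, exp_mulRight_apply,
    exp_mulLeft_apply, one_mul]

theorem gcom_neg (X Y : H →L[ℂ] H) : gcom (-X) (-Y) = -gcom X Y := by
  ext T x
  simp [gcom_apply]
  abel

theorem hasSum_gcom (X Y : H →L[ℂ] H) :
    HasSum (fun n : ℕ => ((1 - (-1) ^ (n + 1)) * ((n + 1).factorial : ℝ)⁻¹) •
        ((gcom X Y ^ n) (X - Y)))
      (NormedSpace.exp X * NormedSpace.exp (-Y) - NormedSpace.exp (-X) * NormedSpace.exp Y) := by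
  have h1 := (NormedSpace.exp_series_hasSum_exp' (𝕂 := ℝ)
    (gcom X Y)).mapL (ContinuousLinearMap.apply ℝ _ (1 : H →L[ℂ] H))
  have h2 := (NormedSpace.exp_series_hasSum_exp' (𝕂 := ℝ)
    (gcom (-X) (-Y))).mapL (ContinuousLinearMap.apply ℝ _ (1 : H →L[ℂ] H))
  have h3 := h1.sub h2
  simp only [ContinuousLinearMap.apply_apply, exp_gcom, neg_neg] at h3
  rw [← hasSum_nat_add_iff' 1] at h3
  refine (hasSum_congr_both ?_ ?_).mpr h3
  · intro n
    have hneg : ∀ n, ((gcom (-X) (-Y)) ^ n) 1 = (-1 : ℝ) ^ n • ((gcom X Y) ^ n) 1 := by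
      intro n
      induction n with
      | zero => simp
      | succ n ih =>
        rw [pow_succ', clm_mul_app, ih, map_smul, gcom_neg, pow_succ', pow_succ' (gcom X Y),
          clm_mul_app, neg_apply, mul_smul, smul_neg, neg_one_smul]
    have h4 : (gcom X Y ^ (n + 1)) 1 = (gcom X Y ^ n) (X - Y) := by
      rw [pow_succ, clm_mul_app, gcom_apply, mul_one, one_mul]
    simp only [smul_apply, hneg, h4]
    rw [smul_smul, ← sub_smul]
    congr 1
    ring
  · simp

theorem gcom_hs {e : HilbertBasis ι ℂ H} (X Y : H →L[ℂ] H) {T : H →L[ℂ] H} (hT : IsHS e T) :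
    IsHS e (gcom X Y T) := by
  rw [gcom_apply]
  exact (hT.mul_left X).sub (hT.mul_right Y)

theorem gcom_pow_hs {e : HilbertBasis ι ℂ H} (X Y : H →L[ℂ] H) {T : H →L[ℂ] H} (hT : IsHS e T)
    (n : ℕ) : IsHS e ((gcom X Y ^ n) T) ∧
      hsNorm e ((gcom X Y ^ n) T) ≤ (‖X‖ + ‖Y‖) ^ n * hsNorm e T := by
  induction n with
  | zero => simp [hT]
  | succ n ih =>
    rw [pow_succ', clm_mul_app]
    refine ⟨gcom_hs X Y ih.1, ?_⟩
    rw [gcom_apply]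
    have h1 := hsNorm_mul_left ih.1 X
    have h2 := hsNorm_mul_right ih.1 Y
    have h3 := hsNorm_sub_le (ih.1.mul_left X) (ih.1.mul_right Y)
    calc _ ≤ (‖X‖ + ‖Y‖) * hsNorm e ((gcom X Y ^ n) T) := by linarith
      _ ≤ (‖X‖ + ‖Y‖) * ((‖X‖ + ‖Y‖) ^ n * hsNorm e T) := by gcongr; exact ih.2
      _ = _ := by ring

theorem hsip_comm (e : HilbertBasis ι ℂ H) (A B : H →L[ℂ] H) : hsip e A B = hsip e B A := by
  rw [hsip, hsip, ← inner_conj_symm, Complex.conj_re]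

theorem gcom_symm {e : HilbertBasis ι ℂ H} {X Y : H →L[ℂ] H} (hX : IsSelfAdjoint X)
    (hY : IsSelfAdjoint Y) {A B : H →L[ℂ] H} (hA : IsHS e A) (hB : IsHS e B) :
    hsip e (gcom X Y A) B = hsip e A (gcom X Y B) := by
  have h1 := hsip_mul_left hA hB hX
  have h2 := hsip_mul_right hA hB hY
  rw [gcom_apply, gcom_apply]
  unfold hsip at *
  rw [hsv_sub (hA.mul_left X) (hA.mul_right Y), hsv_sub (hB.mul_left X) (hB.mul_right Y),
    inner_sub_left, inner_sub_right, Complex.sub_re, Complex.sub_re, h1, h2]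

theorem gcom_pow_symm {e : HilbertBasis ι ℂ H} {X Y : H →L[ℂ] H} (hX : IsSelfAdjoint X)
    (hY : IsSelfAdjoint Y) (n : ℕ) {A B : H →L[ℂ] H} (hA : IsHS e A) (hB : IsHS e B) :
    hsip e ((gcom X Y ^ n) A) B = hsip e A ((gcom X Y ^ n) B) := by
  induction n generalizing B with
  | zero => simp
  | succ n ih =>
    rw [pow_succ', clm_mul_app, gcom_symm hX hY (gcom_pow_hs X Y hA n).1 hB,
      ih (gcom_hs X Y hB), ← clm_mul_app (gcom X Y ^ n), ← pow_succ, pow_succ']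

theorem gcom_pow_nonneg {e : HilbertBasis ι ℂ H} {X Y : H →L[ℂ] H} (hX : IsSelfAdjoint X)
    (hY : IsSelfAdjoint Y) (n : ℕ) {A : H →L[ℂ] H} (hA : IsHS e A) :
    0 ≤ hsip e A ((gcom X Y ^ (n + n)) A) := by
  rw [pow_add, clm_mul_app, ← gcom_pow_symm hX hY n hA (gcom_pow_hs X Y hA n).1,
    hsip_self (gcom_pow_hs X Y hA n).1]
  positivity

theorem sinh_increasing {e : HilbertBasis ι ℂ H} {X Y : H →L[ℂ] H} (hX : IsSelfAdjoint X)
    (hY : IsSelfAdjoint Y) (hW : IsHS e (X - Y)) :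
    2 * hsNorm e (X - Y) ≤ hsNorm e
      (NormedSpace.exp X * NormedSpace.exp (-Y) - NormedSpace.exp (-X) * NormedSpace.exp Y) := by
  set V := NormedSpace.exp X * NormedSpace.exp (-Y) - NormedSpace.exp (-X) * NormedSpace.exp Y
    with hV
  set W := X - Y with hWdef
  set c : ℕ → ℝ := fun n => (1 - (-1) ^ (n + 1)) * ((n + 1).factorial : ℝ)⁻¹ with hc
  have hsum : HasSum (fun n => c n • ((gcom X Y ^ n) W)) V := hasSum_gcom X Y
  have hc0 : ∀ n, 0 ≤ c n := by
    intro n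
    refine mul_nonneg ?_ (by positivity)
    rcases neg_one_pow_eq_or ℝ (n + 1) with h | h <;> rw [h] <;> norm_num
  have hc1 : ∀ n, c n ≤ 2 * (n.factorial : ℝ)⁻¹ := by
    intro n
    have h1 : (1 - (-1 : ℝ) ^ (n + 1)) ≤ 2 := by
      rcases neg_one_pow_eq_or ℝ (n + 1) with h | h <;> rw [h] <;> norm_num
    refine mul_le_mul h1 ?_ (by positivity) (by norm_num)
    gcongr
    exact Nat.le_succ n
  have hHS := fun n => gcom_pow_hs (e := e) X Y hW n
  have hs : Summable (fun n => c n • hsv e ((gcom X Y ^ n) W)) := by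
    refine Summable.of_norm_bounded (g := fun n : ℕ => 2 * hsNorm e W *
      ((‖X‖ + ‖Y‖) ^ n / n.factorial)) ((Real.summable_pow_div_factorial _).mul_left _) ?_
    intro n
    rw [norm_smul, Real.norm_of_nonneg (hc0 n), norm_hsv e (hHS n).1]
    calc _ ≤ (2 * (n.factorial : ℝ)⁻¹) * ((‖X‖ + ‖Y‖) ^ n * hsNorm e W) :=
          mul_le_mul (hc1 n) (hHS n).2 (hsNorm_nonneg _ _) (by positivity)
      _ = _ := by ring
  obtain ⟨v, hv⟩ := hs
  have hvi : ∀ i, v i = V (e i) := by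
    intro i
    have h1 : HasSum (fun n => (c n • hsv e ((gcom X Y ^ n) W)) i) (v i) :=
      hv.mapL (lp.evalCLM ℝ (fun _ : ι => H) 2 i)
    have h2 : HasSum (fun n => (c n • ((gcom X Y ^ n) W)) (e i)) (V (e i)) :=
      hsum.mapL ((ContinuousLinearMap.apply ℂ H (e i)).restrictScalars ℝ)
    refine h1.unique ?_
    convert h2 using 2 with n
    rw [lp.coeFn_smul, Pi.smul_apply, hsv_apply e (hHS n).1, smul_apply]
  have hVHS : IsHS e V := by
    rw [isHS_iff_memlp]
    have := lp.memℓp v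
    convert this using 1
    ext i
    exact (hvi i).symm
  have hvV : v = hsv e V := by
    ext i
    rw [hvi, hsv_apply e hVHS]
  have hip : HasSum (fun n => c n * hsip e W ((gcom X Y ^ n) W)) (hsip e W V) := by
    have := (hv.mapL ((innerSL ℂ (hsv e W)).restrictScalars ℝ)).mapL Complex.reCLM
    rw [hvV] at this
    refine (hasSum_congr_both ?_ rfl).mpr this
    intro n
    simp only [hsip, ContinuousLinearMap.coe_restrictScalars', map_smul, innerSL_apply_apply,
      smul_eq_mul]
    rfl
  have hle : 2 * hsNorm e W ^ 2 ≤ hsip e W V := by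
    have h1 := le_hasSum hip 0 (fun n _ => by
      rcases Nat.even_or_odd n with ⟨m, hm⟩ | ho
      · subst hm
        exact mul_nonneg (hc0 _) (gcom_pow_nonneg hX hY m hW)
      · have : c n = 0 := by
          simp only [hc]
          rw [Even.neg_one_pow (by exact ho.add_one)]
          simp
        simp [this])
    have h2 : c 0 = 2 := by simp [hc]; norm_num
    simpa [h2, hsip_self hW] using h1
  have hcs : hsip e W V ≤ hsNorm e W * hsNorm e V := by
    rw [← norm_hsv e hW, ← norm_hsv e hVHS]
    exact re_inner_le_norm (𝕜 := ℂ) _ _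
  rcases (hsNorm_nonneg e W).eq_or_lt with h0 | h0
  · rw [← h0]; simpa using hsNorm_nonneg e V
  · have : hsNorm e W * (2 * hsNorm e W) ≤ hsNorm e W * hsNorm e V := by nlinarith
    exact le_of_mul_le_mul_left this h0

theorem rexp_add (A : H →L[ℂ] H) (s t : ℝ) :
    NormedSpace.exp (s • A) * NormedSpace.exp (t • A) = NormedSpace.exp ((s + t) • A) := by
  let +nondep : NormedAlgebra ℚ (H →L[ℂ] H) := NormedAlgebra.restrictScalars ℚ ℝ _
  rw [add_smul, NormedSpace.exp_add_of_commute]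
  exact ((Commute.refl A).smul_left s).smul_right t

theorem rexp_half (A : H →L[ℂ] H) :
    NormedSpace.exp ((1 / 2 : ℝ) • A) * NormedSpace.exp ((1 / 2 : ℝ) • A) = NormedSpace.exp A := by
  rw [rexp_add]; norm_num

theorem rexp_mul_neg (A : H →L[ℂ] H) (s : ℝ) :
    NormedSpace.exp (s • A) * NormedSpace.exp ((-s) • A) = 1 := by
  rw [rexp_add]; simp

theorem rexp_neg_mul (A : H →L[ℂ] H) (s : ℝ) :
    NormedSpace.exp ((-s) • A) * NormedSpace.exp (s • A) = 1 := by
  rw [rexp_add]; simp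

theorem smul_sa {A : H →L[ℂ] H} (hA : IsSelfAdjoint A) (s : ℝ) : IsSelfAdjoint (s • A) := by
  rw [isSelfAdjoint_iff, star_smul, hA.star_eq, star_trivial]

theorem rexp_sa {A : H →L[ℂ] H} (hA : IsSelfAdjoint A) (s : ℝ) :
    IsSelfAdjoint (NormedSpace.exp (s • A)) := by
  rw [isSelfAdjoint_iff, NormedSpace.star_exp, (smul_sa hA s).star_eq]


theorem rexp_isUnit (A : H →L[ℂ] H) (s : ℝ) : IsUnit (NormedSpace.exp (s • A)) := by
  exact ⟨⟨_, _, rexp_mul_neg A s, rexp_neg_mul A s⟩, rfl⟩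

theorem plog_exp {A : H →L[ℂ] H} (hA : IsSelfAdjoint A) : plog (NormedSpace.exp A) = A :=
  CFC.log_exp A hA

theorem exp_of_pos {p : H →L[ℂ] H} (hp : 0 ≤ p) (hu : IsUnit p) :
    ∃ A : H →L[ℂ] H, IsSelfAdjoint A ∧ p = NormedSpace.exp A := by
  refine ⟨CFC.log p, IsSelfAdjoint.log, (CFC.exp_log p ?_).symm⟩
  exact hu.isStrictlyPositive hp

theorem exp_of_unit {g : H →L[ℂ] H} (hu : IsUnit g) :
    ∃ A : H →L[ℂ] H, IsSelfAdjoint A ∧ g * star g = NormedSpace.exp A :=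
  exp_of_pos (mul_star_self_nonneg g) (hu.mul hu.star)

theorem exp_of_congr {g A : H →L[ℂ] H} (hu : IsUnit g) (hA : IsSelfAdjoint A) :
    ∃ B : H →L[ℂ] H, IsSelfAdjoint B ∧ g * NormedSpace.exp A * star g = NormedSpace.exp B := by
  obtain ⟨B, hB, h⟩ := exp_of_unit (hu.mul (rexp_isUnit A (1 / 2)))
  refine ⟨B, hB, ?_⟩
  rw [← h, star_mul, (rexp_sa hA _).star_eq, ← rexp_half A]
  simp only [mul_assoc]

theorem psqrt_exp {A : H →L[ℂ] H} (hA : IsSelfAdjoint A) :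
    psqrt (NormedSpace.exp A) = NormedSpace.exp ((1 / 2 : ℝ) • A) := by
  rw [psqrt, ← CFC.real_exp_eq_normedSpace_exp hA, ← cfc_comp' Real.sqrt Real.exp A,
    ← CFC.real_exp_eq_normedSpace_exp (smul_sa hA _), ← cfc_smul_id (R := ℝ) (1 / 2) A,
    ← cfc_comp' Real.exp (fun x => (1 / 2 : ℝ) • x) A]
  refine cfc_congr fun x _ => ?_
  simp only [smul_eq_mul]
  rw [Real.sqrt_eq_iff_mul_self_eq (by positivity) (by positivity), ← Real.exp_add]
  ring_nf

theorem pinvsqrt_exp {A : H →L[ℂ] H} (hA : IsSelfAdjoint A) :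
    pinvsqrt (NormedSpace.exp A) = NormedSpace.exp ((-(1 / 2) : ℝ) • A) := by
  have hc : ContinuousOn (fun t : ℝ => (Real.sqrt t)⁻¹) (Real.exp '' spectrum ℝ A) := by
    refine ContinuousOn.inv₀ (by fun_prop) ?_
    rintro _ ⟨x, _, rfl⟩
    exact (Real.sqrt_pos.mpr (Real.exp_pos x)).ne'
  rw [pinvsqrt, ← CFC.real_exp_eq_normedSpace_exp hA,
    ← cfc_comp' (fun t : ℝ => (Real.sqrt t)⁻¹) Real.exp A hc,
    ← CFC.real_exp_eq_normedSpace_exp (smul_sa hA _), ← cfc_smul_id (R := ℝ) (-(1 / 2)) A,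
    ← cfc_comp' Real.exp (fun x => (-(1 / 2) : ℝ) • x) A]
  refine cfc_congr fun x _ => ?_
  have h : Real.sqrt (Real.exp x) = Real.exp (1 / 2 * x) := by
    rw [Real.sqrt_eq_iff_mul_self_eq (by positivity) (by positivity), ← Real.exp_add]
    ring_nf
  simp only [smul_eq_mul, h, ← Real.exp_neg]
  ring_nf

theorem dslope_exp_cont : Continuous (dslope Real.exp 0) := by
  rw [← continuousOn_univ, continuousOn_dslope Filter.univ_mem]
  exact ⟨Real.continuous_exp.continuousOn, Real.differentiableAt_exp⟩

theorem dslope_exp_eq (x : ℝ) : x * dslope Real.exp 0 x = Real.exp x - 1 := by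
  have := sub_smul_dslope Real.exp 0 x
  simpa using this

theorem dslope_exp_ne (x : ℝ) : dslope Real.exp 0 x ≠ 0 := by
  intro h
  have h1 := dslope_exp_eq x
  rw [h] at h1
  have h2 : x = 0 := by
    rw [← Real.exp_eq_one_iff]; linarith
  subst h2
  simp at h

theorem exp_sub_one_eq {A : H →L[ℂ] H} (hA : IsSelfAdjoint A) :
    NormedSpace.exp A - 1 = A * cfc (dslope Real.exp 0) A := by
  have hc := dslope_exp_cont
  calc _ = cfc (fun x => Real.exp x - 1) A := by
        rw [cfc_sub Real.exp (fun _ => 1) A (by fun_prop) (by fun_prop),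
          CFC.real_exp_eq_normedSpace_exp hA, cfc_const_one ℝ A]
    _ = cfc (fun x => x * dslope Real.exp 0 x) A := by simp_rw [dslope_exp_eq]
    _ = cfc (fun x => x) A * cfc (dslope Real.exp 0) A := by
        rw [cfc_mul (fun x => x) _ A (by fun_prop) (by fun_prop)]
    _ = _ := by rw [cfc_id' ℝ A]

theorem eq_exp_sub_one {A : H →L[ℂ] H} (hA : IsSelfAdjoint A) :
    A = (NormedSpace.exp A - 1) * cfc (fun x => (dslope Real.exp 0 x)⁻¹) A := by
  have hc := dslope_exp_cont
  have hc' : Continuous (fun x => (dslope Real.exp 0 x)⁻¹) := hc.inv₀ dslope_exp_ne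
  rw [exp_sub_one_eq hA, mul_assoc, ← cfc_mul _ _ A hc.continuousOn hc'.continuousOn]
  simp_rw [mul_inv_cancel₀ (dslope_exp_ne _)]
  rw [cfc_const_one ℝ A, mul_one]

theorem hs_exp {e : HilbertBasis ι ℂ H} {A : H →L[ℂ] H} (hA : IsSelfAdjoint A) (h : IsHS e A) :
    IsHS e (NormedSpace.exp A - 1) := by
  rw [exp_sub_one_eq hA]; exact h.mul_right _

theorem hs_of_exp {e : HilbertBasis ι ℂ H} {A : H →L[ℂ] H} (hA : IsSelfAdjoint A)
    (h : IsHS e (NormedSpace.exp A - 1)) : IsHS e A := by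
  rw [eq_exp_sub_one hA]; exact h.mul_right _

/-- The function `x ↦ 2 sinh (x / 2)`. -/
def tsinh (x : ℝ) : ℝ := Real.exp ((1 / 2 : ℝ) • x) - Real.exp ((-(1 / 2) : ℝ) • x)

theorem tsinh_abs (x : ℝ) : |tsinh x| ≤ |x| * Real.exp (|x| / 2) := by
  have key : ∀ y : ℝ, 0 ≤ y →
      Real.exp (1 / 2 * y) - Real.exp (-(1 / 2) * y) ≤ y * Real.exp (y / 2) := by
    intro y hy
    have h1 := Real.add_one_le_exp (-y)
    have h2 : Real.exp (-(1 / 2) * y) = Real.exp (-y) * Real.exp (y / 2) := by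
      rw [← Real.exp_add]; ring_nf
    rw [h2, show (1 / 2 : ℝ) * y = y / 2 by ring]
    nlinarith [Real.exp_pos (y / 2)]
  have mono : ∀ y : ℝ, 0 ≤ y → Real.exp (-(1 / 2) * y) ≤ Real.exp (1 / 2 * y) := by
    intro y hy
    apply Real.exp_le_exp.mpr; linarith
  simp only [tsinh, smul_eq_mul]
  rcases le_total 0 x with h | h
  · rw [abs_of_nonneg h, abs_of_nonneg (by linarith [mono x h])]
    exact key x h
  · have h1 := key (-x) (by linarith)
    have h2 := mono (-x) (by linarith)
    rw [abs_of_nonpos h, abs_sub_comm, abs_of_nonneg]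
    · have e1 : -(1 / 2) * x = 1 / 2 * (-x) := by ring
      have e2 : 1 / 2 * x = -(1 / 2) * (-x) := by ring
      rw [e1, e2]; exact h1
    · have e1 : -(1 / 2) * x = 1 / 2 * (-x) := by ring
      have e2 : 1 / 2 * x = -(1 / 2) * (-x) := by ring
      rw [e1, e2]; linarith

theorem tsinh_diff : Differentiable ℝ tsinh := by
  unfold tsinh; fun_prop

theorem dslope_tsinh_cont : Continuous (dslope tsinh 0) := by
  rw [← continuousOn_univ, continuousOn_dslope Filter.univ_mem]
  exact ⟨tsinh_diff.continuous.continuousOn, tsinh_diff 0⟩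

theorem dslope_tsinh_eq (x : ℝ) : x * dslope tsinh 0 x = tsinh x := by
  have := sub_smul_dslope tsinh 0 x
  simpa [tsinh] using this

theorem dslope_tsinh_abs (x : ℝ) : |dslope tsinh 0 x| ≤ Real.exp (|x| / 2) := by
  have hne : ∀ y : ℝ, y ≠ 0 → |dslope tsinh 0 y| ≤ Real.exp (|y| / 2) := by
    intro y hy
    have h1 := tsinh_abs y
    rw [← dslope_tsinh_eq, abs_mul] at h1
    exact le_of_mul_le_mul_left h1 (abs_pos.mpr hy)
  rcases eq_or_ne x 0 with rfl | hx
  · have hc1 : Continuous (fun y => |dslope tsinh 0 y|) := dslope_tsinh_cont.abs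
    have hc2 : Continuous (fun y : ℝ => Real.exp (|y| / 2)) := by fun_prop
    refine le_of_tendsto_of_tendsto (b := nhdsWithin 0 {0}ᶜ) (hc1.continuousAt.mono_left nhdsWithin_le_nhds)
      (hc2.continuousAt.mono_left nhdsWithin_le_nhds) ?_
    filter_upwards [self_mem_nhdsWithin] with y hy
    exact hne y hy
  · exact hne x hx

theorem exp_half_sub {e : HilbertBasis ι ℂ H} {A : H →L[ℂ] H} (hA : IsSelfAdjoint A)
    (h : IsHS e A) :
    hsNorm e (NormedSpace.exp ((1 / 2 : ℝ) • A) - NormedSpace.exp ((-(1 / 2) : ℝ) • A)) ≤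
      hsNorm e A * Real.exp (‖A‖ / 2) := by
  have hc := dslope_tsinh_cont
  have heq : NormedSpace.exp ((1 / 2 : ℝ) • A) - NormedSpace.exp ((-(1 / 2) : ℝ) • A)
      = A * cfc (dslope tsinh 0) A := by
    have h1 : ∀ s : ℝ, NormedSpace.exp (s • A) = cfc (fun x => Real.exp (s • x)) A := by
      intro s
      rw [← CFC.real_exp_eq_normedSpace_exp (smul_sa hA _), ← cfc_smul_id (R := ℝ) s A,
        ← cfc_comp' Real.exp (fun x => s • x) A]
    rw [h1, h1, ← cfc_sub _ _ A (by fun_prop) (by fun_prop)]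
    calc _ = cfc (fun x => x * dslope tsinh 0 x) A := by simp_rw [dslope_tsinh_eq]; rfl
      _ = cfc (fun x => x) A * cfc (dslope tsinh 0) A := by
        rw [cfc_mul (fun x => x) _ A (by fun_prop) (by fun_prop)]
      _ = _ := by rw [cfc_id' ℝ A]
  rw [heq]
  refine (hsNorm_mul_right h _).trans ?_
  refine mul_le_mul_of_nonneg_left ?_ (hsNorm_nonneg _ _)
  refine norm_cfc_le (by positivity) fun x hx => ?_
  refine (dslope_tsinh_abs x).trans ?_
  have : |x| ≤ ‖A‖ := by
    rcases subsingleton_or_nontrivial H with hs | hs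
    · have : Subsingleton (H →L[ℂ] H) := inferInstance
      simp [spectrum.of_subsingleton] at hx
    · exact spectrum.norm_le_norm_of_mem hx
  gcongr

theorem abstract_polar {R : Type*} [Ring R] [StarRing R] {g gi x xi y yi h hi : R}
    (h1 : g * gi = 1) (h2 : gi * g = 1) (hx : x * xi = 1) (hx' : xi * x = 1)
    (hy : y * yi = 1) (hh : h * hi = 1) (hh' : hi * h = 1)
    (sx : star xi = xi) (sy : star y = y) (sh : star hi = hi)
    (hxx : x * x = g * star g) (hyy : y * y = g * (h * h) * star g) :
    ∃ U V : R, star U * U = 1 ∧ V * star V = 1 ∧ xi * y = U * h * V ∧ x * yi = U * hi * V := by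
  have hsg : star g * star gi = 1 := by rw [← star_mul, h2, star_one]
  have hUU' : (xi * g) * (star g * xi) = 1 := by
    calc _ = xi * (g * star g) * xi := by simp only [mul_assoc]
      _ = (xi * x) * (x * xi) := by rw [← hxx]; simp only [mul_assoc]
      _ = 1 := by rw [hx', hx, one_mul]
  have hxixi : xi * xi = star gi * gi := by
    calc xi * xi = xi * xi * (g * (star g * star gi) * gi) := by rw [hsg, mul_one, h1, mul_one]
      _ = xi * xi * (g * star g) * (star gi * gi) := by simp only [mul_assoc]
      _ = xi * (xi * x) * x * (star gi * gi) := by rw [← hxx]; simp only [mul_assoc]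
      _ = _ := by rw [hx', mul_one, hx', one_mul]
  have hUU : (star g * xi) * (xi * g) = 1 := by
    calc _ = star g * (xi * xi) * g := by simp only [mul_assoc]
      _ = (star g * star gi) * (gi * g) := by rw [hxixi]; simp only [mul_assoc]
      _ = 1 := by rw [hsg, h2, one_mul]
  have hyy' : xi * y * (y * xi) = (xi * g) * (h * h) * (star g * xi) := by
    calc _ = xi * (y * y) * xi := by simp only [mul_assoc]
      _ = _ := by rw [hyy]; simp only [mul_assoc]
  refine ⟨xi * g, hi * (star g * xi) * (xi * y), ?_, ?_, ?_, ?_⟩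
  · rw [star_mul, sx, hUU]
  · simp only [star_mul, sx, sy, sh, star_star]
    calc _ = hi * (star g * xi) * (xi * y * (y * xi)) * ((xi * g) * hi) := by
            simp only [mul_assoc]
      _ = hi * ((star g * xi) * (xi * g)) * (h * h) * ((star g * xi) * (xi * g)) * hi := by
            rw [hyy']; simp only [mul_assoc]
      _ = (hi * h) * (h * hi) := by rw [hUU]; simp only [mul_assoc, mul_one, one_mul]
      _ = 1 := by rw [hh, hh', one_mul]
  · calc xi * y = (xi * g) * (star g * xi) * (xi * y) := by rw [hUU', one_mul]
      _ = (xi * g) * (h * hi) * (star g * xi) * (xi * y) := by rw [hh, mul_one]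
      _ = _ := by simp only [mul_assoc]
  · have : (xi * g) * hi * (hi * (star g * xi) * (xi * y)) * y = x := by
      calc _ = (xi * g) * hi * hi * (star g * xi) * xi * (y * y) := by simp only [mul_assoc]
        _ = (xi * g) * hi * hi * ((star g * xi) * (xi * g)) * (h * h) * star g := by
            rw [hyy]; simp only [mul_assoc]
        _ = (xi * g) * hi * (hi * h) * h * star g := by rw [hUU]; simp only [mul_assoc, one_mul]
        _ = (xi * g) * hi * 1 * h * star g := by rw [hh']
        _ = (xi * g) * (hi * h) * star g := by simp only [mul_one, mul_assoc]
        _ = xi * (g * star g) := by rw [hh', mul_one, mul_assoc]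
        _ = x := by rw [← hxx, ← mul_assoc, hx', one_mul]
    calc x * yi = (xi * g) * hi * (hi * (star g * xi) * (xi * y)) * (y * yi) := by
            rw [← mul_assoc _ y yi, this]
      _ = _ := by rw [hy, mul_one]

theorem emi_local {e : HilbertBasis ι ℂ H} {g A X Y : H →L[ℂ] H} (hu : IsUnit g)
    (hA : IsSelfAdjoint A) (hX : IsSelfAdjoint X) (hY : IsSelfAdjoint Y)
    (sA : IsHS e A) (sX : IsHS e X) (sY : IsHS e Y)
    (hgX : g * star g = NormedSpace.exp X) (hgY : g * NormedSpace.exp A * star g = NormedSpace.exp Y) :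
    hsNorm e (X - Y) ≤ hsNorm e A * Real.exp (‖A‖ / 2) := by
  obtain ⟨u, rfl⟩ := hu
  have key := sinh_increasing (e := e) (smul_sa hX (-(1 / 2))) (smul_sa hY (-(1 / 2)))
    ((sX.smul _).sub (sY.smul _))
  rw [← smul_sub, hsNorm_smul, ← neg_smul, ← neg_smul, neg_neg] at key
  obtain ⟨U, V, hU, hV, h1, h2⟩ := abstract_polar (g := (u : H →L[ℂ] H)) (gi := ↑u⁻¹)
    (x := NormedSpace.exp ((1 / 2 : ℝ) • X)) (xi := NormedSpace.exp ((-(1 / 2) : ℝ) • X))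
    (y := NormedSpace.exp ((1 / 2 : ℝ) • Y)) (yi := NormedSpace.exp ((-(1 / 2) : ℝ) • Y))
    (h := NormedSpace.exp ((1 / 2 : ℝ) • A)) (hi := NormedSpace.exp ((-(1 / 2) : ℝ) • A))
    (by simp) (by simp) (rexp_mul_neg X _) (rexp_neg_mul X _) (rexp_mul_neg Y _)
    (rexp_mul_neg A _) (rexp_neg_mul A _) (rexp_sa hX _).star_eq (rexp_sa hY _).star_eq
    (rexp_sa hA _).star_eq (by rw [rexp_half, hgX]) (by rw [rexp_half, rexp_half, hgY])
  rw [h1, h2, ← sub_mul, ← mul_sub, hsNorm_unitary_right e _ hV, hsNorm_unitary_left e _ hU] at key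
  have := exp_half_sub hA sA
  rw [show |(-(1 / 2) : ℝ)| = 1 / 2 by norm_num [abs_of_pos]] at key
  linarith

theorem congr_hs {e : HilbertBasis ι ℂ H} {g A : H →L[ℂ] H} (hg : IsHS e (g * star g - 1))
    (hA : IsSelfAdjoint A) (sA : IsHS e A) :
    IsHS e (g * NormedSpace.exp A * star g - 1) := by
  have : g * NormedSpace.exp A * star g - 1
      = g * (NormedSpace.exp A - 1) * star g + (g * star g - 1) := by
    rw [mul_sub, sub_mul, mul_one]; abel
  rw [this]
  exact (((hs_exp hA sA).mul_left _).mul_right _).add hg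

theorem congr_repr {e : HilbertBasis ι ℂ H} {g A : H →L[ℂ] H} (hu : IsUnit g)
    (hg : IsHS e (g * star g - 1)) (hA : IsSelfAdjoint A) (sA : IsHS e A) :
    ∃ B : H →L[ℂ] H, IsSelfAdjoint B ∧ IsHS e B ∧
      g * NormedSpace.exp A * star g = NormedSpace.exp B := by
  obtain ⟨B, hB, h⟩ := exp_of_congr hu hA
  refine ⟨B, hB, hs_of_exp hB ?_, h⟩
  rw [← h]; exact congr_hs hg hA sA

theorem unit_repr {e : HilbertBasis ι ℂ H} {g : H →L[ℂ] H} (hu : IsUnit g)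
    (hg : IsHS e (g * star g - 1)) :
    ∃ B : H →L[ℂ] H, IsSelfAdjoint B ∧ IsHS e B ∧ g * star g = NormedSpace.exp B := by
  obtain ⟨B, hB, h⟩ := exp_of_unit hu
  refine ⟨B, hB, hs_of_exp hB ?_, h⟩
  rw [← h]; exact hg

theorem exp_inj {A B : H →L[ℂ] H} (hA : IsSelfAdjoint A) (hB : IsSelfAdjoint B)
    (h : NormedSpace.exp A = NormedSpace.exp B) : A = B := by
  rw [← plog_exp hA, h, plog_exp hB]

/-- `(g e^{sZ}) e^{tZ} (g e^{sZ})^* = g e^{(2s+t)Z} g^*`. -/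
theorem shift_conj {g Z : H →L[ℂ] H} (hZ : IsSelfAdjoint Z) (s t : ℝ) :
    (g * NormedSpace.exp (s • Z)) * NormedSpace.exp (t • Z) * star (g * NormedSpace.exp (s • Z))
      = g * NormedSpace.exp ((2 * s + t) • Z) * star g := by
  rw [star_mul, (rexp_sa hZ s).star_eq]
  calc _ = g * (NormedSpace.exp (s • Z) * NormedSpace.exp (t • Z) * NormedSpace.exp (s • Z))
        * star g := by simp only [mul_assoc]
    _ = _ := by rw [rexp_add, rexp_add]; ring_nf

theorem shift_self {g Z : H →L[ℂ] H} (hZ : IsSelfAdjoint Z) (s : ℝ) :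
    (g * NormedSpace.exp (s • Z)) * star (g * NormedSpace.exp (s • Z))
      = g * NormedSpace.exp ((2 * s) • Z) * star g := by
  have := shift_conj (g := g) hZ s 0
  simpa using this

theorem shift_unit {g : H →L[ℂ] H} (hu : IsUnit g) (Z : H →L[ℂ] H) (s : ℝ) :
    IsUnit (g * NormedSpace.exp (s • Z)) := hu.mul (rexp_isUnit Z s)

theorem emi_steps {e : HilbertBasis ι ℂ H} {g Z X : H →L[ℂ] H} (hu : IsUnit g)
    (hZ : IsSelfAdjoint Z) (hX : IsSelfAdjoint X)
    (sZ : IsHS e Z) (sX : IsHS e X)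
    (hgX : g * star g = NormedSpace.exp X) (s : ℝ) (hs : 0 ≤ s) (k : ℕ) :
    ∀ Y : H →L[ℂ] H, IsSelfAdjoint Y → IsHS e Y →
      g * NormedSpace.exp ((k * s) • Z) * star g = NormedSpace.exp Y →
      hsNorm e (X - Y) ≤ k * (s * hsNorm e Z * Real.exp (s * ‖Z‖ / 2)) := by
  have hg : IsHS e (g * star g - 1) := by rw [hgX]; exact hs_exp hX sX
  induction k with
  | zero =>
    intro Y hY sY h
    simp only [Nat.cast_zero, zero_mul, zero_smul, NormedSpace.exp_zero, mul_one] at h ⊢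
    have : X = Y := exp_inj hX hY (by rw [← hgX, h])
    rw [this, sub_self]
    simp [hsNorm]
  | succ k ih =>
    intro Y hY sY h
    obtain ⟨W, hW, sW, hgW⟩ := congr_repr hu hg (smul_sa hZ (k * s)) (sZ.smul (k * s))
    have h1 := ih W hW sW hgW
    have h2 := emi_local (e := e) (g := g * NormedSpace.exp ((k * s / 2) • Z)) (A := s • Z)
      (X := W) (Y := Y) (shift_unit hu Z _) (smul_sa hZ s) hW hY (sZ.smul s) sW sY
      (by rw [shift_self hZ, ← hgW]; ring_nf) (by rw [shift_conj hZ, ← h]; push_cast; ring_nf)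
    rw [hsNorm_smul, abs_of_nonneg hs, norm_smul, Real.norm_of_nonneg hs] at h2
    have h3 := hsNorm_add_le (sX.sub sW) (sW.sub sY)
    rw [sub_add_sub_cancel] at h3
    push_cast
    linarith

theorem emi {e : HilbertBasis ι ℂ H} {g Z X Y : H →L[ℂ] H} (hu : IsUnit g)
    (hZ : IsSelfAdjoint Z) (hX : IsSelfAdjoint X) (hY : IsSelfAdjoint Y)
    (sZ : IsHS e Z) (sX : IsHS e X) (sY : IsHS e Y)
    (hgX : g * star g = NormedSpace.exp X)
    (hgY : g * NormedSpace.exp Z * star g = NormedSpace.exp Y) :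
    hsNorm e (X - Y) ≤ hsNorm e Z := by
  have key : ∀ n : ℕ, hsNorm e (X - Y) ≤ hsNorm e Z * Real.exp (1 / ((n : ℝ) + 1) * (‖Z‖ / 2)) := by
    intro n
    have hn : ((n : ℝ) + 1) ≠ 0 := by positivity
    have := emi_steps (e := e) hu hZ hX sZ sX hgX (1 / ((n : ℝ) + 1)) (by positivity) (n + 1) Y hY sY
      (by push_cast; rw [mul_one_div_cancel hn, one_smul, hgY])
    refine this.trans (le_of_eq ?_)
    push_cast
    rw [mul_div_assoc, mul_assoc, ← mul_assoc, mul_one_div_cancel hn, one_mul]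
  have hlim : Filter.Tendsto (fun n : ℕ => hsNorm e Z * Real.exp (1 / ((n : ℝ) + 1) * (‖Z‖ / 2)))
      Filter.atTop (nhds (hsNorm e Z * Real.exp (0 * (‖Z‖ / 2)))) := by
    refine Filter.Tendsto.const_mul _ ?_
    exact (Real.continuous_exp.tendsto _).comp (tendsto_one_div_add_atTop_nhds_zero_nat.mul_const _)
  rw [zero_mul, Real.exp_zero, mul_one] at hlim
  exact ge_of_tendsto' hlim key

theorem gdist_formula {e : HilbertBasis ι ℂ H} {g Z : H →L[ℂ] H} (hu : IsUnit g)
    (hZ : IsSelfAdjoint Z) :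
    gdist e (g * star g) (g * NormedSpace.exp Z * star g) = hsNorm e Z := by
  obtain ⟨X, hX, hgX⟩ := exp_of_unit hu
  rw [gdist]
  nth_rw 1 [hgX]
  rw [show pinvsqrt (g * star g) = pinvsqrt (NormedSpace.exp X) by rw [hgX], pinvsqrt_exp hX]
  set xi := NormedSpace.exp ((-(1 / 2) : ℝ) • X) with hxi
  have hxs : star xi = xi := (rexp_sa hX _).star_eq
  have hUu : IsUnit (xi * g) := (rexp_isUnit X _).mul hu
  have hUU : (xi * g) * star (xi * g) = 1 := by
    rw [star_mul, hxs]
    calc _ = xi * (g * star g) * xi := by simp only [mul_assoc]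
      _ = (xi * NormedSpace.exp ((1 / 2 : ℝ) • X)) * (NormedSpace.exp ((1 / 2 : ℝ) • X) * xi) := by
        rw [hgX, ← rexp_half X]; simp only [mul_assoc]
      _ = 1 := by rw [hxi, rexp_neg_mul, rexp_mul_neg, one_mul]
  have hUU' : star (xi * g) * (xi * g) = 1 := by
    obtain ⟨u, hu'⟩ := hUu
    have h3 : star (xi * g) = ↑u⁻¹ := by
      rw [← hu'] at hUU ⊢
      exact (Units.eq_inv_of_mul_eq_one_left hUU)
    rw [h3, ← hu', Units.inv_mul]
  have h4 : xi * (g * NormedSpace.exp Z * star g) * xi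
      = NormedSpace.exp ((xi * g) * Z * star (xi * g)) := by
    let +nondep : NormedAlgebra ℚ (H →L[ℂ] H) := NormedAlgebra.restrictScalars ℚ ℝ _
    have := NormedSpace.exp_units_conj ⟨xi * g, star (xi * g), hUU, hUU'⟩ Z
    rw [show ((⟨xi * g, star (xi * g), hUU, hUU'⟩ : (H →L[ℂ] H)ˣ) : H →L[ℂ] H) = xi * g from rfl,
      show (↑(⟨xi * g, star (xi * g), hUU, hUU'⟩ : (H →L[ℂ] H)ˣ)⁻¹ : H →L[ℂ] H)
        = star (xi * g) from rfl] at this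
    rw [this]
    simp only [star_mul, hxs, mul_assoc]
  have hsa : IsSelfAdjoint ((xi * g) * Z * star (xi * g)) := by
    rw [isSelfAdjoint_iff]
    simp only [star_mul, star_star, hZ.star_eq, mul_assoc]
  rw [h4, plog_exp hsa, hsNorm_unitary_right e _ (by rw [star_star]; exact hUU'),
    hsNorm_unitary_left e _ hUU']

/-- `p` is the exponential of a self-adjoint Hilbert–Schmidt operator. -/
def PD (e : HilbertBasis ι ℂ H) (p : H →L[ℂ] H) : Prop :=
  ∃ A : H →L[ℂ] H, IsSelfAdjoint A ∧ IsHS e A ∧ p = NormedSpace.exp A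

theorem MemP.pd {e : HilbertBasis ι ℂ H} {p : H →L[ℂ] H} (hp : MemP e p) : PD e p := by
  obtain ⟨h1, h2, h3, h4⟩ := hp
  have h0 : 0 ≤ p := by
    rw [ContinuousLinearMap.nonneg_iff_isPositive, ContinuousLinearMap.isPositive_def']
    exact ⟨h1, h3⟩
  obtain ⟨A, hA, h⟩ := exp_of_pos h0 h2
  exact ⟨A, hA, hs_of_exp hA (by rw [← h]; exact h4), h⟩

theorem PD.sq {e : HilbertBasis ι ℂ H} {p : H →L[ℂ] H} (hp : PD e p) :
    ∃ g : H →L[ℂ] H, IsUnit g ∧ IsHS e (g * star g - 1) ∧ p = g * star g := by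
  obtain ⟨A, hA, sA, rfl⟩ := hp
  have : NormedSpace.exp A
      = NormedSpace.exp ((1 / 2 : ℝ) • A) * star (NormedSpace.exp ((1 / 2 : ℝ) • A)) := by
    rw [(rexp_sa hA _).star_eq, rexp_half]
  exact ⟨_, rexp_isUnit A (1 / 2), by rw [← this]; exact hs_exp hA sA, this⟩

theorem PD.of_unit {e : HilbertBasis ι ℂ H} {g : H →L[ℂ] H} (hu : IsUnit g)
    (hg : IsHS e (g * star g - 1)) : PD e (g * star g) := unit_repr hu hg

theorem PD.of_congr {e : HilbertBasis ι ℂ H} {g A : H →L[ℂ] H} (hu : IsUnit g)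
    (hg : IsHS e (g * star g - 1)) (hA : IsSelfAdjoint A) (sA : IsHS e A) :
    PD e (g * NormedSpace.exp A * star g) := congr_repr hu hg hA sA

theorem PD.repr {e : HilbertBasis ι ℂ H} {r g : H →L[ℂ] H} (hr : PD e r) (hu : IsUnit g)
    (hg : IsHS e (g * star g - 1)) :
    ∃ Y : H →L[ℂ] H, IsSelfAdjoint Y ∧ IsHS e Y ∧ r = g * NormedSpace.exp Y * star g := by
  obtain ⟨A, hA, sA, rfl⟩ := hr
  obtain ⟨u, rfl⟩ := hu
  set g : H →L[ℂ] H := ↑u with hgd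
  set gi : H →L[ℂ] H := ↑u⁻¹ with hgi
  have h1 : g * gi = 1 := by simp [hgd, hgi]
  have h2 : gi * g = 1 := by simp [hgd, hgi]
  have h3 : star gi * star g = 1 := by rw [← star_mul, h1, star_one]
  have h4 : star g * star gi = 1 := by rw [← star_mul, h2, star_one]
  obtain ⟨Y, hY, h⟩ := exp_of_congr (g := gi) (u⁻¹).isUnit hA
  refine ⟨Y, hY, hs_of_exp hY ?_, ?_⟩
  · rw [← h]
    have : gi * NormedSpace.exp A * star gi - 1
        = gi * ((NormedSpace.exp A - 1) - (g * star g - 1)) * star gi := by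
      rw [sub_sub_sub_cancel_right, mul_sub, sub_mul]
      congr 1
      rw [← mul_assoc gi, h2, one_mul, h4]
    rw [this]
    exact (((hs_exp hA sA).sub hg).mul_left _).mul_right _
  · rw [← h]
    calc NormedSpace.exp A = (g * gi) * NormedSpace.exp A * (star gi * star g) := by
          rw [h1, h3, one_mul, mul_one]
      _ = _ := by simp only [mul_assoc]

theorem emi_gdist {e : HilbertBasis ι ℂ H} {k X Y : H →L[ℂ] H} (hk : IsUnit k)
    (hX : IsSelfAdjoint X) (hY : IsSelfAdjoint Y) (sX : IsHS e X) (sY : IsHS e Y) :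
    hsNorm e (X - Y) ≤
      gdist e (k * NormedSpace.exp X * star k) (k * NormedSpace.exp Y * star k) := by
  have hs := (rexp_sa hX (1 / 2)).star_eq
  have hx : NormedSpace.exp ((1 / 2 : ℝ) • X) * star (NormedSpace.exp ((1 / 2 : ℝ) • X))
      = NormedSpace.exp X := by rw [hs, rexp_half]
  obtain ⟨Z, hZ, sZ, h⟩ := PD.repr ⟨Y, hY, sY, rfl⟩ (rexp_isUnit X (1 / 2))
    (by rw [hx]; exact hs_exp hX sX)
  have h1 := emi (rexp_isUnit X (1 / 2)) hZ hX hY sZ sX sY hx h.symm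
  have h2 := gdist_formula (e := e) (hk.mul (rexp_isUnit X (1 / 2))) hZ
  have e1 : k * NormedSpace.exp X * star k = k * NormedSpace.exp ((1 / 2 : ℝ) • X) *
      star (k * NormedSpace.exp ((1 / 2 : ℝ) • X)) := by
    rw [← hx, star_mul]; simp only [mul_assoc]
  have e2 : k * NormedSpace.exp Y * star k = k * NormedSpace.exp ((1 / 2 : ℝ) • X) *
      NormedSpace.exp Z * star (k * NormedSpace.exp ((1 / 2 : ℝ) • X)) := by
    rw [h, star_mul]; simp only [mul_assoc]
  rw [e1, e2, h2]
  exact h1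

theorem gdist_nonneg (e : HilbertBasis ι ℂ H) (p q : H →L[ℂ] H) : 0 ≤ gdist e p q :=
  hsNorm_nonneg _ _

theorem gdist_comm {e : HilbertBasis ι ℂ H} {p q : H →L[ℂ] H} (hp : PD e p) (hq : PD e q) :
    gdist e p q = gdist e q p := by
  obtain ⟨g, hu, hg, rfl⟩ := hp.sq
  obtain ⟨Z, hZ, sZ, rfl⟩ := hq.repr hu hg
  rw [gdist_formula hu hZ]
  have h := gdist_formula (e := e) (shift_unit hu Z (1 / 2)) (smul_sa hZ (-1))
  rw [shift_self hZ, shift_conj hZ, hsNorm_smul] at h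
  norm_num at h
  exact h.symm

theorem gdist_triangle {e : HilbertBasis ι ℂ H} {p q r : H →L[ℂ] H} (hp : PD e p) (hq : PD e q)
    (hr : PD e r) : gdist e p r ≤ gdist e p q + gdist e q r := by
  obtain ⟨g, hu, hg, rfl⟩ := hp.sq
  obtain ⟨Y, hY, sY, rfl⟩ := hq.repr hu hg
  obtain ⟨Z, hZ, sZ, rfl⟩ := hr.repr hu hg
  have h1 := emi_gdist (e := e) hu hY hZ sY sZ
  rw [gdist_formula hu hY, gdist_formula hu hZ]
  have h2 := hsNorm_sub_le sY (sY.sub sZ)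
  rw [sub_sub_cancel] at h2
  linarith

/-- `m` is the point of parameter `t` on the geodesic from `p` to `q`. -/
def Mid (e : HilbertBasis ι ℂ H) (t : ℝ) (p q m : H →L[ℂ] H) : Prop :=
  ∃ g Z : H →L[ℂ] H, IsUnit g ∧ IsHS e (g * star g - 1) ∧ IsSelfAdjoint Z ∧ IsHS e Z ∧
    p = g * star g ∧ q = g * NormedSpace.exp Z * star g ∧
    m = g * NormedSpace.exp (t • Z) * star g

theorem Mid.exists {e : HilbertBasis ι ℂ H} {p q : H →L[ℂ] H} (hp : PD e p) (hq : PD e q) (t : ℝ) :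
    ∃ m, Mid e t p q m := by
  obtain ⟨g, hu, hg, rfl⟩ := hp.sq
  obtain ⟨Z, hZ, sZ, rfl⟩ := hq.repr hu hg
  exact ⟨_, g, Z, hu, hg, hZ, sZ, rfl, rfl, rfl⟩

theorem Mid.pd₁ {e : HilbertBasis ι ℂ H} {p q m : H →L[ℂ] H} {t : ℝ} (h : Mid e t p q m) :
    PD e p := by
  obtain ⟨g, Z, hu, hg, hZ, sZ, rfl, rfl, rfl⟩ := h
  exact PD.of_unit hu hg

theorem Mid.pd₂ {e : HilbertBasis ι ℂ H} {p q m : H →L[ℂ] H} {t : ℝ} (h : Mid e t p q m) :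
    PD e q := by
  obtain ⟨g, Z, hu, hg, hZ, sZ, rfl, rfl, rfl⟩ := h
  exact PD.of_congr hu hg hZ sZ

theorem Mid.pd {e : HilbertBasis ι ℂ H} {p q m : H →L[ℂ] H} {t : ℝ} (h : Mid e t p q m) :
    PD e m := by
  obtain ⟨g, Z, hu, hg, hZ, sZ, rfl, rfl, rfl⟩ := h
  exact PD.of_congr hu hg (smul_sa hZ t) (sZ.smul t)

theorem Mid.reverse {e : HilbertBasis ι ℂ H} {p q m : H →L[ℂ] H} {t : ℝ} (h : Mid e t p q m) :
    Mid e (1 - t) q p m := by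
  obtain ⟨g, Z, hu, hg, hZ, sZ, rfl, rfl, rfl⟩ := h
  have hq : (g * NormedSpace.exp ((1 / 2 : ℝ) • Z)) * star (g * NormedSpace.exp ((1 / 2 : ℝ) • Z))
      = g * NormedSpace.exp Z * star g := by
    rw [shift_self hZ]; norm_num
  refine ⟨g * NormedSpace.exp ((1 / 2 : ℝ) • Z), (-1 : ℝ) • Z, shift_unit hu Z _, ?_,
    smul_sa hZ _, sZ.smul _, hq.symm, ?_, ?_⟩
  · rw [hq]; exact congr_hs hg hZ sZ
  · rw [shift_conj hZ]; norm_num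
  · rw [smul_smul, shift_conj hZ]; ring_nf

theorem Mid.dist {e : HilbertBasis ι ℂ H} {p q m : H →L[ℂ] H} {t : ℝ} (h : Mid e t p q m) :
    gdist e p m = |t| * gdist e p q := by
  obtain ⟨g, Z, hu, hg, hZ, sZ, rfl, rfl, rfl⟩ := h
  rw [gdist_formula hu hZ, gdist_formula hu (smul_sa hZ t), hsNorm_smul]

theorem norm_comb {e : HilbertBasis ι ℂ H} {Y Z : H →L[ℂ] H} (sY : IsHS e Y) (sZ : IsHS e Z)
    (r : ℝ) : hsNorm e (r • Z - Y) ^ 2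
      = r ^ 2 * hsNorm e Z ^ 2 - 2 * r * hsip e Z Y + hsNorm e Y ^ 2 := by
  have h := norm_sub_sq (𝕜 := ℂ) (hsv e (r • Z)) (hsv e Y)
  rw [← hsv_sub (sZ.smul r) sY, norm_hsv e ((sZ.smul r).sub sY), norm_hsv e (sZ.smul r),
    norm_hsv e sY, hsNorm_smul, mul_pow, sq_abs] at h
  have h2 : (inner ℂ (hsv e (r • Z)) (hsv e Y) : ℂ).re = r * hsip e Z Y := by
    rw [hsv_smul sZ, RCLike.real_smul_eq_coe_smul (K := ℂ), inner_smul_left, hsip]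
    simp
  rw [h, show RCLike.re (inner ℂ (hsv e (r • Z)) (hsv e Y) : ℂ) = _ from h2]
  ring

theorem Mid.cn {e : HilbertBasis ι ℂ H} {p q m r : H →L[ℂ] H} {t : ℝ} (h : Mid e t p q m)
    (hr : PD e r) (h0 : 0 ≤ t) (h1 : t ≤ 1) :
    gdist e m r ^ 2 ≤ (1 - t) * gdist e p r ^ 2 + t * gdist e q r ^ 2
      - t * (1 - t) * gdist e p q ^ 2 := by
  obtain ⟨g, Z, hu, hg, hZ, sZ, rfl, rfl, rfl⟩ := h
  have hk := shift_unit hu Z (t / 2)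
  have hm : (g * NormedSpace.exp ((t / 2) • Z)) * star (g * NormedSpace.exp ((t / 2) • Z))
      = g * NormedSpace.exp (t • Z) * star g := by
    rw [shift_self hZ]; ring_nf
  have hp : (g * NormedSpace.exp ((t / 2) • Z)) * NormedSpace.exp ((-t) • Z)
      * star (g * NormedSpace.exp ((t / 2) • Z)) = g * star g := by
    rw [shift_conj hZ]; ring_nf; simp
  have hq : (g * NormedSpace.exp ((t / 2) • Z)) * NormedSpace.exp ((1 - t) • Z)
      * star (g * NormedSpace.exp ((t / 2) • Z)) = g * NormedSpace.exp Z * star g := by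
    rw [shift_conj hZ]; ring_nf; simp
  rw [gdist_formula hu hZ]
  obtain ⟨Y, hY, sY, rfl⟩ := hr.repr hk
    (by rw [hm]; exact congr_hs hg (smul_sa hZ t) (sZ.smul t))
  have a1 := emi_gdist (e := e) hk (smul_sa hZ (-t)) hY (sZ.smul (-t)) sY
  have a2 := emi_gdist (e := e) hk (smul_sa hZ (1 - t)) hY (sZ.smul (1 - t)) sY
  rw [hp] at a1
  rw [hq] at a2
  rw [← hm, gdist_formula hk hY]
  have b1 := pow_le_pow_left₀ (hsNorm_nonneg _ _) a1 2
  have b2 := pow_le_pow_left₀ (hsNorm_nonneg _ _) a2 2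
  rw [norm_comb sY sZ] at b1 b2
  have c1 := mul_le_mul_of_nonneg_left b1 (sub_nonneg.mpr h1)
  have c2 := mul_le_mul_of_nonneg_left b2 h0
  linarith

theorem Mid.contract {e : HilbertBasis ι ℂ H} {p q r m n : H →L[ℂ] H} {t : ℝ}
    (h : Mid e t p q m) (h' : Mid e t p r n) (h0 : 0 ≤ t) (h1 : t ≤ 1) :
    gdist e m n ≤ t * gdist e q r := by
  have a := h'.cn h.pd h0 h1
  have b := h.cn h'.pd₂ h0 h1
  rw [gdist_comm h'.pd h.pd, h.dist, abs_of_nonneg h0, gdist_comm h'.pd₂ h.pd] at a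
  have c := mul_le_mul_of_nonneg_left b h0
  refine le_of_sq_le_sq ?_ (mul_nonneg h0 (gdist_nonneg _ _ _))
  nlinarith

theorem geo_pd {e : HilbertBasis ι ℂ H} {p K : H →L[ℂ] H} (hp : MemP e p) (hK : MemS2 e K)
    {a b α β : ℝ} (hαβ : α + β = 1) :
    Mid e β (geoCurve p K a) (geoCurve p K b) (geoCurve p K (α * a + β * b)) := by
  obtain ⟨A, hA, sA, rfl⟩ := hp.pd
  obtain ⟨hK, sK⟩ := hK
  have hs := (rexp_sa hA (1 / 2)).star_eq
  have hx : NormedSpace.exp ((1 / 2 : ℝ) • A) * star (NormedSpace.exp ((1 / 2 : ℝ) • A))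
      = NormedSpace.exp A := by rw [hs, rexp_half]
  have hc : ∀ t : ℝ, geoCurve (NormedSpace.exp A) K t = NormedSpace.exp ((1 / 2 : ℝ) • A)
      * NormedSpace.exp (t • K) * star (NormedSpace.exp ((1 / 2 : ℝ) • A)) := by
    intro t
    rw [geoCurve, psqrt_exp hA, hs]
  have hu := rexp_isUnit A (1 / 2)
  have hself := shift_self (g := NormedSpace.exp ((1 / 2 : ℝ) • A)) hK (a / 2)
  rw [mul_div_cancel₀ a two_ne_zero] at hself
  refine ⟨NormedSpace.exp ((1 / 2 : ℝ) • A) * NormedSpace.exp ((a / 2) • K), (b - a) • K,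
    shift_unit hu K _, ?_, smul_sa hK _, sK.smul _, ?_, ?_, ?_⟩
  · rw [hself]
    exact congr_hs (by rw [hx]; exact hs_exp hA sA) (smul_sa hK a) (sK.smul a)
  · rw [hc, hself]
  · rw [hc, shift_conj hK]; ring_nf
  · rw [hc, smul_smul, shift_conj hK]
    congr 4
    rw [← eq_sub_iff_add_eq] at hαβ
    rw [hαβ]; ring

/-- The distance between two constant-speed geodesics of `P` is a
convex function of the parameter. -/
theorem statement8 (e : HilbertBasis ι ℂ H) (p₁ p₂ H₁ H₂ : H →L[ℂ] H)
    (hp₁ : MemP e p₁) (hp₂ : MemP e p₂) (hH₁ : MemS2 e H₁) (hH₂ : MemS2 e H₂) :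
    ConvexOn ℝ Set.univ (fun t : ℝ => gdist e (geoCurve p₁ H₁ t) (geoCurve p₂ H₂ t)) := by
  refine ⟨convex_univ, fun a _ b _ α β hα hβ hαβ => ?_⟩
  simp only [smul_eq_mul]
  have m1 := geo_pd (a := a) (b := b) hp₁ hH₁ hαβ
  have m2 := geo_pd (a := a) (b := b) hp₂ hH₂ hαβ
  obtain ⟨n, hn⟩ := Mid.exists m1.pd₁ m2.pd₂ β
  have hβ1 : β ≤ 1 := by linarith
  have c1 := m1.contract hn hβ hβ1
  have c2 := hn.reverse.contract m2.reverse (by linarith) (by linarith)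
  have c3 := gdist_triangle m1.pd hn.pd m2.pd
  rw [show 1 - β = α by linarith] at c2
  linarith
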